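/- For n ≥ 2, let (C̃_n, S) be the affine Coxeter system with S = {s_0, s_1,…,s_n}, where m(s_0,s_1) = 4, m(s_i,s_{i+1}) = 3 for 1 ≤ i ≤ n−2, m(s_{n−1},s_n) = 4, and m = 2 for all other pairs of distinct generators. Then every proper parabolic subgroup of C̃_n is finite, χ̂_{C̃_n}(q) is a polynomial, and χ̂_{C̃_n}(q) = Σ_{k=0}^{n} (−1)^k q^{k²} χ̂_{B_{n−k}}(q), where χ̂_{B_m}(q) is the modified characteristic polynomial of the finite Coxeter group of type B_m and χ̂_{B_i}(q) = 1 for i ≤ 0. -/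

import Mathlib

open Polynomial

namespace CoxeterCharPoly

variable {B W : Type*} [Group W] {M : CoxeterMatrix B}

/-- The left weak order on a Coxeter group. -/
def wle (cs : CoxeterSystem M W) (u w : W) : Prop :=
  cs.length w = cs.length (w * u⁻¹) + cs.length u

/-- The standard parabolic subgroup generated by `J ⊆ S`. -/
def parabolic (cs : CoxeterSystem M W) (J : Set B) : Subgroup W :=
  Subgroup.closure (cs.simple '' J)

/- The longest element of the parabolic subgroup `W_J` (junk value if there is
no element of maximal length). -/
open Classical in
noncomputable def w0 (cs : CoxeterSystem M W) (J : Set B) : W :=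
  if h : ∃ w ∈ parabolic cs J, ∀ u ∈ parabolic cs J, cs.length u ≤ cs.length w
  then h.choose else 1

/-- The right descent set of `w`, as a subset of `B`. -/
def rightDescents (cs : CoxeterSystem M W) (w : W) : Set B :=
  {i | cs.IsRightDescent w i}

/- `μ` is the Möbius function of the subposet `A` of the order `le`. -/
open Classical in
def IsMobiusOn {α : Type*} (le : α → α → Prop) (A : Set α) (μ : α → α → ℤ) : Prop :=
  ∀ a ∈ A, ∀ b ∈ A, le a b →
    (∑ᶠ t ∈ {t | t ∈ A ∧ le a t ∧ le t b}, μ a t) = if a = b then 1 else 0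

/-- The Coxeter matrix of affine type `C̃ₙ`: generators `s₀, s₁, …, s_n` with `m(s₀,s₁) = 4`, `m(s_i,s_{i+1}) = 3` for `1 ≤ i ≤ n-2`, `m(s_{n-1},s_n) = 4`, and `m = 2` for all other pairs -/
def tCmat (n : ℕ) : CoxeterMatrix (Fin (n + 1)) where
  M := Matrix.of fun i j =>
    if i = j then 1
    else if (min (i : ℕ) (j : ℕ) = 0 ∧ max (i : ℕ) (j : ℕ) = 1) ∨ (min (i : ℕ) (j : ℕ) + 1 = max (i : ℕ) (j : ℕ) ∧ max (i : ℕ) (j : ℕ) = n) then 4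
    else if min (i : ℕ) (j : ℕ) + 1 = max (i : ℕ) (j : ℕ) ∧ 1 ≤ min (i : ℕ) (j : ℕ) ∧ max (i : ℕ) (j : ℕ) + 1 ≤ n then 3
    else 2
  isSymm := by
    ext i j
    simp only [Matrix.transpose_apply, Matrix.of_apply]
    by_cases h : i = j
    · subst h; rfl
    · rw [if_neg (Ne.symm h), if_neg h, min_comm, max_comm]
  diagonal := by intro i; simp
  off_diagonal := by
    intro i j h
    simp only [Matrix.of_apply, if_neg h]
    split <;> [simp; skip]
    split <;> simp

/-- The length of the longest element of the standard parabolic subgroup `W_J` of the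
Coxeter group of type `Bₙ`. -/
noncomputable def lenB (n : ℕ) (J : Finset (Fin n)) : ℕ :=
  (CoxeterMatrix.Bₙ n).toCoxeterSystem.length
    (w0 (CoxeterMatrix.Bₙ n).toCoxeterSystem (↑J : Set (Fin n)))

/-- The modified characteristic polynomial `χ̂_{Bₙ}(q) = Σ_{J ⊆ S} (-1)^|J| q^(ℓ(w0(J)))`
of the finite Coxeter group of type `Bₙ` (so `χ̂_{B₀} = 1`). -/
noncomputable def chiB (n : ℕ) : Polynomial ℤ :=
  ∑ J : Finset (Fin n), (-1 : Polynomial ℤ) ^ J.card * X ^ lenB n J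

/-- The modified characteristic polynomial of the affine Coxeter group associated to
`tCmat`: `χ̂(q) = Σ_{J ⊆ S, W_J finite} (-1)^|J| q^(ℓ(w0(J)))`. -/
noncomputable def chiAffC (n : ℕ) : Polynomial ℤ :=
  ∑ᶠ J ∈ {J : Finset (Fin (n + 1)) |
      ((parabolic (tCmat n).toCoxeterSystem (↑J : Set (Fin (n + 1)))) :
        Set (tCmat n).Group).Finite},
    (-1 : Polynomial ℤ) ^ J.card *
      X ^ (tCmat n).toCoxeterSystem.length
        (w0 (tCmat n).toCoxeterSystem (↑J : Set (Fin (n + 1))))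

section General

variable {B W : Type*} [Group W] {M : CoxeterMatrix B} (cs : CoxeterSystem M W)

theorem exists_eq_mul_simple {w : W} {i : B} (h : ¬ cs.length w < cs.length (w * cs.simple i)) :
    ∃ v, w = v * cs.simple i ∧ cs.length w = cs.length v + 1 := by
  refine ⟨w * cs.simple i, by simp, ?_⟩
  have := cs.length_mul_simple w i
  omega

theorem finite_of_length_le [Finite B] {N : ℕ} (h : ∀ w, cs.length w ≤ N) : Finite W := by
  have hfin := (List.finite_length_le B N).image cs.wordProd
  refine Set.finite_univ_iff.1 (hfin.subset fun w _ => ?_)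
  obtain ⟨ω, hω, rfl⟩ := cs.exists_isReduced w
  exact ⟨ω, hω.symm.trans_le (h _), rfl⟩

theorem parabolic_univ : parabolic cs Set.univ = ⊤ := by
  rw [parabolic, Set.image_univ, cs.subgroup_closure_range_simple]

theorem length_w0_eq {J : Set B} {w : W} (hw : w ∈ parabolic cs J)
    (hmax : ∀ u ∈ parabolic cs J, cs.length u ≤ cs.length w) :
    cs.length (w0 cs J) = cs.length w := by
  have h : ∃ w ∈ parabolic cs J, ∀ u ∈ parabolic cs J, cs.length u ≤ cs.length w := ⟨w, hw, hmax⟩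
  rw [w0, dif_pos h]
  exact le_antisymm (hmax _ h.choose_spec.1) (h.choose_spec.2 _ hw)

end General

/-! ### Integral reflection representations -/

section Reflection

variable {B : Type*} {M : CoxeterMatrix B}

/-- `A` is an integral Cartan matrix for the Coxeter matrix `M`, all of whose off-diagonal
entries lie in `{2, 3, 4}`. -/
structure IsCartan (M : CoxeterMatrix B) (A : Matrix B B ℤ) : Prop where
  diag : ∀ i, A i i = 2
  off_diag : ∀ i j, i ≠ j →
    (M i j = 2 ∧ A i j = 0 ∧ A j i = 0) ∨ (M i j = 3 ∧ A i j = -1 ∧ A j i = -1) ∨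
    (M i j = 4 ∧ A i j = -1 ∧ A j i = -2) ∨ (M i j = 4 ∧ A i j = -2 ∧ A j i = -1)

variable [DecidableEq B]

/-- The simple root indexed by `i`. -/
def root (i : B) : B → ℤ := Pi.single i 1

theorem root_nonneg (i : B) : 0 ≤ root i := by
  rw [root, Pi.single_nonneg]; exact zero_le_one

theorem root_ne_zero (i : B) : root i ≠ 0 := by
  simp [root]

variable [Fintype B]

/-- The simple coroot indexed by `i`, as a functional on the root lattice. -/
def coroot (A : Matrix B B ℤ) (i : B) : (B → ℤ) →ₗ[ℤ] ℤ :=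
  LinearMap.proj i ∘ₗ Matrix.mulVecLin A

/-- The simple reflection indexed by `i`. -/
def refl (A : Matrix B B ℤ) (i : B) : Module.End ℤ (B → ℤ) :=
  LinearMap.id - (coroot A i).smulRight (root i)

theorem refl_apply (A : Matrix B B ℤ) (i : B) (v : B → ℤ) :
    refl A i v = v - coroot A i v • root i := rfl

theorem coroot_root (A : Matrix B B ℤ) (i j : B) : coroot A i (root j) = A i j := by
  simp [coroot, root]

theorem map_nonneg {V : Type*} [AddCommGroup V] [PartialOrder V] [IsOrderedAddMonoid V]
    (φ : (B → ℤ) →ₗ[ℤ] V) (h : ∀ i, 0 ≤ φ (root i)) {v : B → ℤ} (hv : 0 ≤ v) : 0 ≤ φ v := by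
  have hsum : v = ∑ i, v i • root i := by
    simpa [root] using pi_eq_sum_univ' v
  rw [hsum, map_sum]
  refine Finset.sum_nonneg fun i _ => ?_
  rw [map_smul]
  exact zsmul_nonneg (h i) (hv i)

variable {A : Matrix B B ℤ}

theorem IsCartan.refl_isLiftable (hA : IsCartan M A) : M.IsLiftable (refl A) := by
  intro i j
  by_cases hij : i = j
  · subst hij
    apply LinearMap.ext
    intro v
    simp only [M.diagonal, pow_one, Module.End.mul_apply, refl_apply, map_sub, map_smul,
      coroot_root, hA.diag, Module.End.one_apply]
    module
  · apply LinearMap.ext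
    intro v
    have h1 := coroot_root A i i
    have h2 := coroot_root A j j
    have h3 := coroot_root A i j
    have h4 := coroot_root A j i
    rw [hA.diag] at h1 h2
    rcases hA.off_diag i j hij with ⟨hm, h, h'⟩ | ⟨hm, h, h'⟩ | ⟨hm, h, h'⟩ | ⟨hm, h, h'⟩ <;>
    · rw [h] at h3
      rw [h'] at h4
      rw [hm]
      simp only [pow_succ, pow_zero, one_mul, Module.End.mul_apply, refl_apply, map_sub, map_smul,
        h1, h2, h3, h4, Module.End.one_apply]
      module

variable {W : Type*} [Group W] (cs : CoxeterSystem M W)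

/-- The reflection representation attached to a Cartan matrix. -/
def rep (hA : IsCartan M A) : W →* Module.End ℤ (B → ℤ) :=
  cs.lift ⟨refl A, hA.refl_isLiftable⟩

theorem rep_simple (hA : IsCartan M A) (i : B) : rep cs hA (cs.simple i) = refl A i :=
  cs.lift_apply_simple _ i

theorem rep_mul_simple_apply (hA : IsCartan M A) (w : W) (i : B) (v : B → ℤ) :
    rep cs hA (w * cs.simple i) v = rep cs hA w v - coroot A i v • rep cs hA w (root i) := by
  rw [map_mul, rep_simple, Module.End.mul_apply, refl_apply, map_sub, map_smul]

theorem rep_mul_simple_root (hA : IsCartan M A) (w : W) (i : B) :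
    rep cs hA (w * cs.simple i) (root i) = -rep cs hA w (root i) := by
  rw [rep_mul_simple_apply, coroot_root, hA.diag]
  module

theorem rep_root_ne_zero (hA : IsCartan M A) (w : W) (i : B) : rep cs hA w (root i) ≠ 0 := by
  intro h
  apply root_ne_zero i
  have : rep cs hA (w⁻¹ * w) (root i) = 0 := by
    rw [map_mul, Module.End.mul_apply, h, map_zero]
  simpa using this

/-- Right ascents of `w` correspond to simple roots made positive by `w`. -/
theorem rep_root_nonneg (hA : IsCartan M A) {w : W} {i : B}
    (h : cs.length w < cs.length (w * cs.simple i)) : 0 ≤ rep cs hA w (root i) := by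
  induction hl : cs.length w using Nat.strong_induction_on generalizing w i with
  | _ l IH =>
  subst hl
  have IH' : ∀ (v : W) (k : B), cs.length v < cs.length w →
      cs.length v < cs.length (v * cs.simple k) → 0 ≤ rep cs hA v (root k) :=
    fun v k hv hk => IH _ hv hk rfl
  by_cases hw : w = 1
  · subst hw; simpa using root_nonneg i
  obtain ⟨j, hj⟩ := cs.exists_rightDescent_of_ne_one hw
  have hij : i ≠ j := by
    rintro rfl
    exact absurd hj (by unfold CoxeterSystem.IsRightDescent; omega)
  obtain ⟨w₁, rfl, h₁⟩ := exists_eq_mul_simple cs (not_lt.2 hj.le)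
  have e1 := coroot_root A i i
  have e2 := coroot_root A j j
  have e3 := coroot_root A i j
  have e4 := coroot_root A j i
  rw [hA.diag] at e1 e2
  have hc := hA.off_diag i j hij
  by_cases a₁ : cs.length w₁ < cs.length (w₁ * cs.simple i)
  · have p := IH' w₁ i (by omega) a₁
    have q := IH' w₁ j (by omega) (by omega)
    rw [rep_mul_simple_apply, e4, sub_eq_add_neg, ← neg_smul]
    exact add_nonneg p (zsmul_nonneg q (by rcases hc with h | h | h | h <;> omega))
  obtain ⟨w₂, rfl, h₂⟩ := exists_eq_mul_simple cs a₁
  have hr := cs.simple_mul_simple_pow i j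
  have shorter : ∀ v : W, ∀ ω : List B, ∀ x, x = v * cs.wordProd ω →
      cs.length x ≤ cs.length v + ω.length := by
    rintro v ω _ rfl
    have := cs.length_mul_le v (cs.wordProd ω)
    have := cs.length_wordProd_le ω
    omega
  by_cases hm2 : M i j = 2
  · exfalso
    rw [hm2] at hr
    have e : cs.simple i * cs.simple j * cs.simple i = cs.simple j := by
      refine (eq_inv_of_mul_eq_one_left (b := cs.simple j) ?_).trans (by simp)
      simpa only [pow_succ, pow_zero, one_mul, mul_assoc] using hr
    have := shorter w₂ [j] (w₂ * cs.simple i * cs.simple j * cs.simple i) (by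
      simp only [mul_assoc] at e ⊢
      simp [CoxeterSystem.wordProd, e])
    simp only [List.length_cons, List.length_nil] at this
    omega
  by_cases a₂ : cs.length w₂ < cs.length (w₂ * cs.simple j)
  · have p := IH' w₂ i (by omega) (by omega)
    have q := IH' w₂ j (by omega) a₂
    have : rep cs hA (w₂ * cs.simple i * cs.simple j) (root i) =
        (A i j * A j i - 1) • rep cs hA w₂ (root i) + (-A j i) • rep cs hA w₂ (root j) := by
      simp only [rep_mul_simple_apply, e1, e3, e4]
      module
    rw [this]
    refine add_nonneg (zsmul_nonneg p ?_) (zsmul_nonneg q ?_) <;>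
      rcases hc with ⟨h, h', h''⟩ | ⟨h, h', h''⟩ | ⟨h, h', h''⟩ | ⟨h, h', h''⟩ <;>
      simp_all
  obtain ⟨w₃, rfl, h₃⟩ := exists_eq_mul_simple cs a₂
  by_cases hm3 : M i j = 3
  · exfalso
    rw [hm3] at hr
    have e : cs.simple j * cs.simple i * cs.simple j * cs.simple i =
        cs.simple i * cs.simple j := by
      trans cs.simple i * (cs.simple i * cs.simple j) ^ 3 * cs.simple j
      · simp [pow_succ, mul_assoc]
      · rw [hr, mul_one]
    have := shorter w₃ [i, j]
      (w₃ * cs.simple j * cs.simple i * cs.simple j * cs.simple i) (by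
      simp only [mul_assoc] at e ⊢
      simp [CoxeterSystem.wordProd, e])
    simp only [List.length_cons, List.length_nil] at this
    omega
  have hAA : A i j * A j i = 2 := by
    rcases hc with ⟨h, h', h''⟩ | ⟨h, h', h''⟩ | ⟨h, h', h''⟩ | ⟨h, h', h''⟩ <;> simp_all
  have hm4 : M i j = 4 := by omega
  by_cases a₃ : cs.length w₃ < cs.length (w₃ * cs.simple i)
  · have p := IH' w₃ i (by omega) a₃
    have : rep cs hA (w₃ * cs.simple j * cs.simple i * cs.simple j) (root i) =
        (A i j * A j i - 1) • rep cs hA w₃ (root i) +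
          (A j i * (2 - A i j * A j i)) • rep cs hA w₃ (root j) := by
      simp only [rep_mul_simple_apply, e1, e2, e3, e4]
      module
    rw [this, hAA]
    simpa using p
  obtain ⟨w₄, rfl, h₄⟩ := exists_eq_mul_simple cs a₃
  exfalso
  rw [hm4] at hr
  have e : cs.simple i * cs.simple j * cs.simple i * cs.simple j * cs.simple i =
      cs.simple j * cs.simple i * cs.simple j := by
    trans (cs.simple i * cs.simple j) ^ 4 * (cs.simple j * cs.simple i * cs.simple j)
    · simp [pow_succ, mul_assoc]
    · rw [hr, one_mul]
  have := shorter w₄ [j, i, j]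
    (w₄ * cs.simple i * cs.simple j * cs.simple i * cs.simple j * cs.simple i) (by
    simp only [mul_assoc] at e ⊢
    simp [CoxeterSystem.wordProd, e])
  simp only [List.length_cons, List.length_nil] at this
  omega

theorem rep_root_nonneg_iff (hA : IsCartan M A) {w : W} {i : B} :
    0 ≤ rep cs hA w (root i) ↔ cs.length w < cs.length (w * cs.simple i) := by
  refine ⟨fun h => ?_, rep_root_nonneg cs hA⟩
  by_contra hlt
  obtain ⟨v, rfl, hv⟩ := exists_eq_mul_simple cs hlt
  rw [rep_mul_simple_root] at h
  have := rep_root_nonneg cs hA (w := v) (i := i) (by omega)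
  exact rep_root_ne_zero cs hA v i (le_antisymm (neg_nonneg.1 h) this)

theorem length_mul_simple_of_nonneg (hA : IsCartan M A) {w : W} {i : B}
    (h : 0 ≤ rep cs hA w (root i)) : cs.length (w * cs.simple i) = cs.length w + 1 := by
  have := (rep_root_nonneg_iff cs hA).1 h
  have := cs.length_mul_simple w i
  omega

/-- An element making every simple root negative has maximal length. -/
theorem length_le_of_rep_nonpos (hA : IsCartan M A) {w : W}
    (h : ∀ i, rep cs hA w (root i) ≤ 0) (x : W) : cs.length x ≤ cs.length w := by
  suffices cs.length (w * x) + cs.length x = cs.length w by omega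
  induction hl : cs.length x generalizing x with
  | zero => rw [cs.length_eq_zero_iff] at hl; simp [hl]
  | succ l IH =>
    have hx : x ≠ 1 := by rintro rfl; simp at hl
    obtain ⟨i, hi⟩ := cs.exists_rightDescent_of_ne_one hx
    obtain ⟨y, rfl, hy⟩ := exists_eq_mul_simple cs (not_lt.2 hi.le)
    have hyl : cs.length y = l := by omega
    have key := IH y hyl
    have hpos : 0 ≤ rep cs hA y (root i) := rep_root_nonneg cs hA (by omega)
    have hneg : 0 ≤ -rep cs hA (w * y) (root i) := by
      rw [map_mul]
      exact map_nonneg (-rep cs hA w) (fun k => neg_nonneg.2 (h k)) hpos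
    have hnot : ¬ cs.length (w * y) < cs.length (w * y * cs.simple i) := by
      rw [← rep_root_nonneg_iff cs hA]
      intro h0
      exact rep_root_ne_zero cs hA _ i (le_antisymm (neg_nonneg.1 hneg) h0)
    have := cs.length_mul_simple (w * y) i
    rw [← mul_assoc]
    omega

end Reflection

/-! ### Embeddings of Coxeter diagrams -/

section Embedding

variable {B B' W W' : Type*} [Group W] [Group W']
  {M : CoxeterMatrix B} {M' : CoxeterMatrix B'}

/-- The homomorphism of Coxeter groups induced by an inclusion of Coxeter diagrams. -/
def diagramHom (cs' : CoxeterSystem M' W') (cs : CoxeterSystem M W) {ι : B' → B}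
    (hM : ∀ i j, M' i j = M (ι i) (ι j)) : W' →* W :=
  cs'.lift ⟨fun i => cs.simple (ι i), fun i j => by
    rw [hM]; exact cs.simple_mul_simple_pow _ _⟩

variable (cs' : CoxeterSystem M' W') (cs : CoxeterSystem M W) {ι : B' → B}
  (hM : ∀ i j, M' i j = M (ι i) (ι j))

theorem diagramHom_simple (i : B') :
    diagramHom cs' cs hM (cs'.simple i) = cs.simple (ι i) :=
  cs'.lift_apply_simple _ i

theorem diagramHom_mem_parabolic {J : Set B} {J' : Set B'} (h : ∀ i ∈ J', ι i ∈ J) {w : W'}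
    (hw : w ∈ parabolic cs' J') : diagramHom cs' cs hM w ∈ parabolic cs J := by
  have : parabolic cs' J' ≤ (parabolic cs J).comap (diagramHom cs' cs hM) := by
    rw [parabolic, Subgroup.closure_le]
    rintro _ ⟨i, hi, rfl⟩
    rw [SetLike.mem_coe, Subgroup.mem_comap, diagramHom_simple]
    exact Subgroup.subset_closure ⟨ι i, h i hi, rfl⟩
  exact this hw

variable [DecidableEq B] [Fintype B'] [DecidableEq B']
  {A : Matrix B B ℤ} {A' : Matrix B' B' ℤ}

/-- The map of root lattices induced by a map of index sets. -/
def rootMap (ι : B' → B) : (B' → ℤ) →ₗ[ℤ] (B → ℤ) :=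
  ∑ i, (LinearMap.proj i : (B' → ℤ) →ₗ[ℤ] ℤ).smulRight (root (ι i))

theorem rootMap_root (i : B') : rootMap ι (root i) = root (ι i) := by
  simp [rootMap, root, Pi.single_apply]

variable [Fintype B]

theorem end_ext {V : Type*} [AddCommGroup V] {φ ψ : (B → ℤ) →ₗ[ℤ] V}
    (h : ∀ i, φ (root i) = ψ (root i)) : φ = ψ := by
  ext i
  simpa [root] using h i

theorem rep_diagramHom (hA : IsCartan M A) (hA' : IsCartan M' A')
    (hAA : ∀ i j, A' i j = A (ι i) (ι j)) (w : W') (v : B' → ℤ) :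
    rep cs hA (diagramHom cs' cs hM w) (rootMap ι v) = rootMap ι (rep cs' hA' w v) := by
  induction w using cs'.simple_induction generalizing v with
  | one => simp
  | mul w w' h h' => simp only [map_mul, Module.End.mul_apply, h, h']
  | simple i =>
    rw [diagramHom_simple, rep_simple, rep_simple]
    refine LinearMap.congr_fun (f := refl A (ι i) ∘ₗ rootMap ι) (g := rootMap ι ∘ₗ refl A' i)
      (end_ext fun j => ?_) v
    simp only [LinearMap.comp_apply, rootMap_root, refl_apply, coroot_root, map_sub, map_smul, hAA]

/-- If `w` keeps the simple roots of a subdiagram positive, then lengths add in products of `w`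
with elements of the corresponding Coxeter group. -/
theorem length_mul_diagramHom (hA : IsCartan M A) (hA' : IsCartan M' A')
    (hAA : ∀ i j, A' i j = A (ι i) (ι j)) {w : W}
    (hw : ∀ i, 0 ≤ rep cs hA w (root (ι i))) (x : W') :
    cs.length (w * diagramHom cs' cs hM x) = cs.length w + cs'.length x := by
  induction hl : cs'.length x generalizing x with
  | zero => rw [cs'.length_eq_zero_iff] at hl; simp [hl]
  | succ l IH =>
    have hx : x ≠ 1 := by rintro rfl; simp at hl
    obtain ⟨i, hi⟩ := cs'.exists_rightDescent_of_ne_one hx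
    obtain ⟨y, rfl, hy⟩ := exists_eq_mul_simple cs' (not_lt.2 hi.le)
    have hyl : cs'.length y = l := by omega
    rw [map_mul, diagramHom_simple, ← mul_assoc, length_mul_simple_of_nonneg cs hA, IH y hyl,
      add_assoc]
    rw [map_mul, Module.End.mul_apply, ← rootMap_root, rep_diagramHom cs' cs hM hA hA' hAA]
    have hpos : 0 ≤ rep cs' hA' y (root i) := rep_root_nonneg cs' hA' (by omega)
    refine map_nonneg (rep cs hA w ∘ₗ rootMap ι) (fun k => ?_) hpos
    rw [LinearMap.comp_apply, rootMap_root]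
    exact hw k

theorem length_diagramHom (hA : IsCartan M A) (hA' : IsCartan M' A')
    (hAA : ∀ i j, A' i j = A (ι i) (ι j)) (x : W') :
    cs.length (diagramHom cs' cs hM x) = cs'.length x := by
  simpa using length_mul_diagramHom cs' cs hM hA hA' hAA (w := 1)
    (fun i => by simpa using root_nonneg (ι i)) x

end Embedding

/-! ### Type `B` -/

section TypeB

theorem Bₙ_apply (m : ℕ) (i j : Fin m) : CoxeterMatrix.Bₙ m i j =
    if (i : ℕ) = j then 1
    else if (i : ℕ) + 1 = j ∨ (j : ℕ) + 1 = i then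
      (if (i : ℕ) + 1 = m ∨ (j : ℕ) + 1 = m then 4 else 3) else 2 := by
  have hi := i.2
  have hj := j.2
  simp only [CoxeterMatrix.Bₙ, CoxeterMatrix.B, Matrix.of_apply, Fin.ext_iff]
  split_ifs <;> first | rfl | omega

/-- The Cartan matrix of type `B`, with the short simple root last. -/
def cartanB (m : ℕ) : Matrix (Fin m) (Fin m) ℤ := fun i j =>
  if (i : ℕ) = j then 2
  else if (i : ℕ) + 1 = j ∨ (j : ℕ) + 1 = i then (if (i : ℕ) + 1 = m then -2 else -1) else 0

theorem isCartan_cartanB (m : ℕ) : IsCartan (CoxeterMatrix.Bₙ m) (cartanB m) where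
  diag i := by simp [cartanB]
  off_diag i j h := by
    have hi := i.2
    have hj := j.2
    rw [Ne, Fin.ext_iff] at h
    rw [Bₙ_apply]
    simp only [cartanB]
    split_ifs <;> omega

/-- The standard Coxeter system of type `B`. -/
abbrev csB (m : ℕ) : CoxeterSystem (CoxeterMatrix.Bₙ m) (CoxeterMatrix.Bₙ m).Group :=
  (CoxeterMatrix.Bₙ m).toCoxeterSystem

/-- The reflection representation in type `B`. -/
abbrev repB (m : ℕ) : (CoxeterMatrix.Bₙ m).Group →* Module.End ℤ (Fin m → ℤ) :=
  rep (csB m) (isCartan_cartanB m)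

/-- The short positive roots `αⱼ + ⋯ + αₘ₋₁` in type `B`. -/
def shortRoot (m j : ℕ) : Fin m → ℤ := fun i => if j ≤ i then 1 else 0

theorem shortRoot_nonneg (m j : ℕ) : 0 ≤ shortRoot m j := by
  intro i
  simp only [shortRoot, Pi.zero_apply]
  split_ifs <;> norm_num

theorem shortRoot_of_le {m j : ℕ} (h : m ≤ j) : shortRoot m j = 0 := by
  ext i
  have := i.2
  simp only [shortRoot, Pi.zero_apply, ite_eq_right_iff]
  omega

theorem root_eq_shortRoot_sub {m : ℕ} (i : Fin m) :
    root i = shortRoot m i - shortRoot m (i + 1) := by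
  ext l
  simp only [root, shortRoot, Pi.single_apply, Pi.sub_apply, Fin.ext_iff]
  split_ifs <;> omega

theorem coroot_shortRoot {m : ℕ} (i : Fin m) {j : ℕ} (hj : j ≤ m) :
    coroot (cartanB m) i (shortRoot m j) =
      if j = i then (if (i : ℕ) + 1 = m then 2 else 1)
      else if j = i + 1 ∧ j < m then -1 else 0 := by
  induction hj using Nat.decreasingInduction with
  | self =>
    have := i.2
    rw [shortRoot_of_le le_rfl, map_zero]
    split_ifs <;> omega
  | of_succ j hj IH =>
    have h := root_eq_shortRoot_sub (⟨j, hj⟩ : Fin m)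
    have := i.2
    rw [eq_sub_iff_add_eq] at h
    rw [← h, map_add, IH, coroot_root]
    simp only [cartanB]
    split_ifs <;> omega

theorem repB_mul_simple_of_ne {m : ℕ} (w : (CoxeterMatrix.Bₙ m).Group) (i : Fin m) {j : ℕ}
    (h : j ≠ i) (h' : j ≠ i + 1) :
    repB m (w * (csB m).simple i) (shortRoot m j) = repB m w (shortRoot m j) := by
  rcases le_total j m with hj | hj
  · rw [repB, rep_mul_simple_apply, coroot_shortRoot i hj, if_neg h, if_neg (by tauto), zero_smul,
      sub_zero]
  · rw [shortRoot_of_le hj, map_zero, map_zero]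

theorem repB_mul_simple_self {m : ℕ} (w : (CoxeterMatrix.Bₙ m).Group) (i : Fin m)
    (h : (i : ℕ) + 1 < m) :
    repB m (w * (csB m).simple i) (shortRoot m i) = repB m w (shortRoot m (i + 1)) := by
  rw [repB, rep_mul_simple_apply, coroot_shortRoot i i.2.le, root_eq_shortRoot_sub, if_pos rfl,
    if_neg h.ne, map_sub]
  module

theorem repB_mul_simple_succ {m : ℕ} (w : (CoxeterMatrix.Bₙ m).Group) (i : Fin m)
    (h : (i : ℕ) + 1 < m) :
    repB m (w * (csB m).simple i) (shortRoot m (i + 1)) = repB m w (shortRoot m i) := by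
  rw [repB, rep_mul_simple_apply, coroot_shortRoot i h.le, root_eq_shortRoot_sub,
    if_neg (by omega), if_pos ⟨rfl, h⟩, map_sub]
  module

theorem repB_mul_simple_last {m : ℕ} (w : (CoxeterMatrix.Bₙ m).Group) (i : Fin m)
    (h : (i : ℕ) + 1 = m) :
    repB m (w * (csB m).simple i) (shortRoot m i) = -repB m w (shortRoot m i) := by
  rw [repB, rep_mul_simple_apply, coroot_shortRoot i i.2.le, root_eq_shortRoot_sub, if_pos rfl,
    if_pos h, map_sub, shortRoot_of_le h.ge, map_zero]
  module

/-- The longest element of type `B` acts as `-1` and has length `m ^ 2`. -/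
theorem exists_neg_one_typeB (m : ℕ) : ∃ w : (CoxeterMatrix.Bₙ m).Group,
    (csB m).length w = m ^ 2 ∧ ∀ i, repB m w (root i) = -root i := by
  induction m with
  | zero => exact ⟨1, by simp, fun i => i.elim0⟩
  | succ k IH =>
    obtain ⟨w, hw, hneg⟩ := IH
    have hM : ∀ i j : Fin k, CoxeterMatrix.Bₙ k i j = CoxeterMatrix.Bₙ (k + 1) i.succ j.succ := by
      intro i j
      simp only [Bₙ_apply, Fin.val_succ]
      split_ifs <;> omega
    have hAA : ∀ i j : Fin k, cartanB k i j = cartanB (k + 1) i.succ j.succ := by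
      intro i j
      simp only [cartanB, Fin.val_succ]
      split_ifs <;> omega
    set e := shortRoot (k + 1) with he
    have he0 : ∀ j, 0 ≤ e j := shortRoot_nonneg _
    -- `u` is the image of the longest element of the sub-diagram omitting the first node.
    obtain ⟨u, hul, hu0, hu⟩ : ∃ u : (CoxeterMatrix.Bₙ (k + 1)).Group,
        (csB (k + 1)).length u = k ^ 2 ∧ repB _ u (e 0) = e 0 ∧
        ∀ i, 0 < i → repB _ u (e i) = -e i := by
      refine ⟨diagramHom (csB k) (csB (k + 1)) hM w, ?_, ?_, ?_⟩
      · rw [length_diagramHom _ _ hM (isCartan_cartanB _) (isCartan_cartanB _) hAA, hw]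
      · generalize w = w
        induction w using (csB k).simple_induction_right with
        | one => simp
        | mul_simple_right w i ih =>
          rw [map_mul, diagramHom_simple, repB_mul_simple_of_ne _ _ (by simp) (by simp), ih]
      · intro i hi
        obtain ⟨l, rfl⟩ := Nat.exists_eq_add_of_lt hi
        have hmap : rootMap Fin.succ (shortRoot k l) = shortRoot (k + 1) (0 + l + 1) := by
          ext x
          cases x using Fin.cases with
          | zero => simp [rootMap, root, shortRoot, ite_apply, (Fin.succ_ne_zero _).symm]
          | succ i =>
            simp [rootMap, root, shortRoot, ite_apply, Pi.single_apply]
            rw [Finset.sum_eq_single i] <;> simp +contextual [eq_comm]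
        have hwneg : repB k w = -LinearMap.id := end_ext hneg
        rw [he, ← hmap, rep_diagramHom _ _ hM (isCartan_cartanB _) (isCartan_cartanB _) hAA,
          hwneg, LinearMap.neg_apply, LinearMap.id_apply, map_neg]
    -- moving the sign change to the first node
    have step1 : ∀ j ≤ k, ∃ z, (csB (k + 1)).length z = k ^ 2 + j ∧ repB _ z (e j) = e 0 ∧
        (∀ i, j < i → repB _ z (e i) = -e i) ∧ ∀ i, i < j → repB _ z (e i) = -e (i + 1) := by
      intro j
      induction j with
      | zero => exact fun _ => ⟨u, hul, hu0, hu, fun i hi => absurd hi (Nat.not_lt_zero _)⟩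
      | succ j ih =>
        intro hj
        obtain ⟨z, hz, h0, h1, h2⟩ := ih (by omega)
        have hroot : root (⟨j, by omega⟩ : Fin (k + 1)) = e j - e (j + 1) :=
          root_eq_shortRoot_sub _
        refine ⟨z * (csB (k + 1)).simple ⟨j, by omega⟩, ?_, ?_, ?_, ?_⟩
        · rw [length_mul_simple_of_nonneg _ (isCartan_cartanB _), hz, add_assoc]
          rw [hroot, map_sub, h0, h1 _ (by omega), sub_neg_eq_add]
          exact add_nonneg (he0 _) (he0 _)
        · rw [he, repB_mul_simple_succ z ⟨j, _⟩ (by simpa using hj)]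
          exact h0
        · intro i hi
          rw [he, repB_mul_simple_of_ne _ _ (by simp; omega) (by simp; omega)]
          exact h1 i (by omega)
        · intro i hi
          rcases eq_or_ne i j with rfl | hij
          · rw [he, repB_mul_simple_self z ⟨i, _⟩ (by simpa using hj)]
            exact h1 _ (by simp)
          · rw [he, repB_mul_simple_of_ne _ _ (by simpa using hij) (by simp; omega)]
            exact h2 i (by omega)
    have step2 : ∀ r j, r + j = k → ∃ z, (csB (k + 1)).length z = k ^ 2 + k + 1 + r ∧
        repB _ z (e j) = -e 0 ∧
        (∀ i, j < i → repB _ z (e i) = -e i) ∧ ∀ i, i < j → repB _ z (e i) = -e (i + 1) := by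
      intro r
      induction r with
      | zero =>
        rintro j hj
        obtain rfl : j = k := by omega
        obtain ⟨z, hz, h0, h1, h2⟩ := step1 j le_rfl
        have hroot : root (⟨j, by omega⟩ : Fin (j + 1)) = e j - e (j + 1) :=
          root_eq_shortRoot_sub _
        refine ⟨z * (csB (j + 1)).simple ⟨j, by omega⟩, ?_, ?_, ?_, ?_⟩
        · rw [length_mul_simple_of_nonneg _ (isCartan_cartanB _), hz, add_zero]
          rw [hroot, map_sub, h0, h1 _ (by omega), sub_neg_eq_add]
          exact add_nonneg (he0 _) (he0 _)
        · rw [he, repB_mul_simple_last z ⟨j, _⟩ rfl]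
          exact congrArg Neg.neg h0
        · intro i hi
          rw [he, shortRoot_of_le (by omega), map_zero, neg_zero]
        · intro i hi
          rw [he, repB_mul_simple_of_ne _ _ (by simp; omega) (by simp; omega)]
          exact h2 i (by omega)
      | succ r ih =>
        intro j hj
        obtain ⟨z, hz, h0, h1, h2⟩ := ih (j + 1) (by omega)
        have hroot : root (⟨j, by omega⟩ : Fin (k + 1)) = e j - e (j + 1) :=
          root_eq_shortRoot_sub _
        refine ⟨z * (csB (k + 1)).simple ⟨j, by omega⟩, ?_, ?_, ?_, ?_⟩
        · rw [length_mul_simple_of_nonneg _ (isCartan_cartanB _), hz, add_assoc]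
          rw [hroot, map_sub, h0, h2 _ (by omega), sub_neg_eq_add, neg_add_eq_sub, sub_nonneg]
          intro i
          simp only [he, shortRoot]
          split_ifs <;> omega
        · rw [he, repB_mul_simple_self z ⟨j, _⟩ (by simp; omega)]
          exact h0
        · intro i hi
          rcases eq_or_ne i (j + 1) with rfl | hij
          · rw [he, repB_mul_simple_succ z ⟨j, _⟩ (by simp; omega)]
            exact h2 _ (by simp)
          · rw [he, repB_mul_simple_of_ne _ _ (by simp; omega) (by simpa using hij)]
            exact h1 i (by omega)
        · intro i hi
          rw [he, repB_mul_simple_of_ne _ _ (by simp; omega) (by simp; omega)]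
          exact h2 i (by omega)
    obtain ⟨z, hz, h0, h1, -⟩ := step2 k 0 rfl
    have h : ∀ i, repB _ z (e i) = -e i := fun i => by
      rcases Nat.eq_zero_or_pos i with rfl | hi
      exacts [h0, h1 i hi]
    refine ⟨z, by rw [hz]; ring, fun i => ?_⟩
    rw [root_eq_shortRoot_sub, map_sub, h, h]
    abel

theorem length_le_sq_typeB {m : ℕ} (x : (CoxeterMatrix.Bₙ m).Group) :
    (csB m).length x ≤ m ^ 2 := by
  obtain ⟨w, hw, h⟩ := exists_neg_one_typeB m
  rw [← hw]
  refine length_le_of_rep_nonpos _ (isCartan_cartanB m) (fun i => ?_) x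
  rw [h, neg_nonpos]
  exact root_nonneg i

instance finite_typeB (m : ℕ) : Finite (CoxeterMatrix.Bₙ m).Group :=
  finite_of_length_le (csB m) length_le_sq_typeB

theorem exists_length_eq_lenB {m : ℕ} (J : Finset (Fin m)) :
    ∃ w ∈ parabolic (csB m) (↑J : Set (Fin m)), (csB m).length w = lenB m J ∧
      ∀ u ∈ parabolic (csB m) (↑J : Set (Fin m)), (csB m).length u ≤ lenB m J := by
  obtain ⟨w, hw, hmax⟩ := Set.exists_max_image
    (parabolic (csB m) (↑J : Set (Fin m)) : Set (CoxeterMatrix.Bₙ m).Group) (csB m).length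
    (Set.toFinite _) ⟨1, one_mem _⟩
  have h := length_w0_eq (csB m) hw hmax
  exact ⟨w, hw, h.symm, fun u hu => (hmax u hu).trans h.ge⟩

end TypeB

/-! ### Affine type `C` -/

section AffineC

theorem tCmat_apply (n : ℕ) (i j : Fin (n + 1)) : tCmat n i j =
    if (i : ℕ) = j then 1
    else if (i : ℕ) + 1 = j ∨ (j : ℕ) + 1 = i then
      (if (i : ℕ) = 0 ∨ (j : ℕ) = 0 ∨ (i : ℕ) = n ∨ (j : ℕ) = n then 4 else 3) else 2 := by
  have hi := i.2
  have hj := j.2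
  simp only [tCmat, Matrix.of_apply, Fin.ext_iff]
  split_ifs <;> first | rfl | omega

/-- The Cartan matrix of affine type `C̃ₙ`, with both end roots short. -/
def cartanC (n : ℕ) : Matrix (Fin (n + 1)) (Fin (n + 1)) ℤ := fun i j =>
  if (i : ℕ) = j then 2
  else if (i : ℕ) + 1 = j ∨ (j : ℕ) + 1 = i then
    (if (i : ℕ) = 0 ∨ (i : ℕ) = n then -2 else -1) else 0

theorem isCartan_cartanC {n : ℕ} (hn : 2 ≤ n) : IsCartan (tCmat n) (cartanC n) where
  diag i := by simp [cartanC]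
  off_diag i j h := by
    have hi := i.2
    have hj := j.2
    rw [Ne, Fin.ext_iff] at h
    rw [tCmat_apply]
    simp only [cartanC]
    split_ifs <;> omega

/-- The standard Coxeter system of affine type `C̃ₙ`. -/
abbrev csC (n : ℕ) : CoxeterSystem (tCmat n) (tCmat n).Group := (tCmat n).toCoxeterSystem

theorem sum_cartanC {n : ℕ} (hn : 1 ≤ n) (i : Fin (n + 1)) : ∑ j, cartanC n i j = 0 := by
  obtain ⟨i, hi⟩ := i
  let c : ℕ → ℤ := fun j => if i = j then 2
    else if i + 1 = j ∨ j + 1 = i then (if i = 0 ∨ i = n then -2 else -1) else 0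
  have hpartial : ∀ m ≤ n + 1, ∑ j ∈ Finset.range m, c j =
      if m < i then 0
      else if m = i then (if i = 0 then 0 else if i = n then -2 else -1)
      else if m = i + 1 then (if i = 0 then 2 else if i = n then 0 else 1) else 0 := by
    intro m hm
    induction m with
    | zero => rw [Finset.sum_range_zero]; split_ifs <;> omega
    | succ m ih =>
      rw [Finset.sum_range_succ, ih (by omega)]
      simp only [c]
      split_ifs <;> omega
  have h := hpartial (n + 1) le_rfl
  rw [← Fin.sum_univ_eq_sum_range] at h
  refine h.trans ?_
  split_ifs <;> omega

theorem infinite_affineC {n : ℕ} (hn : 2 ≤ n) : Infinite (tCmat n).Group := by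
  rw [← not_finite_iff_infinite]
  intro hfin
  obtain ⟨w, -, hmax⟩ := Set.exists_max_image (Set.univ : Set (tCmat n).Group) (csC n).length
    Set.finite_univ ⟨1, trivial⟩
  have hA := isCartan_cartanC hn
  -- the imaginary root is fixed by the whole group
  set δ : Fin (n + 1) → ℤ := fun _ => 1 with hδ
  have hco : ∀ i, coroot (cartanC n) i δ = 0 := by
    intro i
    have hsum : coroot (cartanC n) i δ = ∑ j, cartanC n i j := by
      simp [coroot, hδ, Matrix.mulVec, dotProduct]
    rw [hsum]
    exact sum_cartanC (by omega) i
  have hfix : ∀ x, rep (csC n) hA x δ = δ := by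
    intro x
    induction x using (csC n).simple_induction_right with
    | one => simp
    | mul_simple_right x i ih => rw [rep_mul_simple_apply, hco, ih, zero_smul, sub_zero]
  have hneg : ∀ i, 0 ≤ (-rep (csC n) hA w) (root i) := by
    intro i
    obtain ⟨v, rfl, hv⟩ := exists_eq_mul_simple (csC n) (not_lt.2 (hmax (w * _) trivial) : ¬ _ <
      (csC n).length (w * (csC n).simple i))
    rw [LinearMap.neg_apply, rep_mul_simple_root, neg_neg]
    exact rep_root_nonneg _ hA (by omega)
  have h := map_nonneg _ hneg (v := δ) (fun _ => zero_le_one)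
  rw [LinearMap.neg_apply, hfix] at h
  exact absurd (h 0) (by simp [hδ])

/-- The inclusion of the first `k` nodes, listed from the special one outwards. -/
def lowNode {n k : ℕ} (hk : k ≤ n) (i : Fin k) : Fin (n + 1) := ⟨k - 1 - i, by omega⟩

/-- The inclusion of the last `n - k` nodes. -/
def highNode (n k : ℕ) : Fin (n - k) ↪ Fin (n + 1) where
  toFun i := ⟨k + 1 + i, by omega⟩
  inj' i j h := by simpa [Fin.ext_iff] using h

theorem highNode_val {n k : ℕ} (i : Fin (n - k)) : (highNode n k i : ℕ) = k + 1 + i := rfl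

theorem coxeter_lowNode {n k : ℕ} (hk : k ≤ n) (i j : Fin k) :
    CoxeterMatrix.Bₙ k i j = tCmat n (lowNode hk i) (lowNode hk j) := by
  have hi := i.2
  have hj := j.2
  simp only [Bₙ_apply, tCmat_apply, lowNode]
  split_ifs <;> omega

theorem cartan_lowNode {n k : ℕ} (hk : k ≤ n) (i j : Fin k) :
    cartanB k i j = cartanC n (lowNode hk i) (lowNode hk j) := by
  have hi := i.2
  have hj := j.2
  simp only [cartanB, cartanC, lowNode]
  split_ifs <;> omega

theorem coxeter_highNode (n k : ℕ) (i j : Fin (n - k)) :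
    CoxeterMatrix.Bₙ (n - k) i j = tCmat n (highNode n k i) (highNode n k j) := by
  have hi := i.2
  have hj := j.2
  have hi' := highNode_val i
  have hj' := highNode_val j
  rw [Bₙ_apply, tCmat_apply]
  split_ifs <;> omega

theorem cartan_highNode (n k : ℕ) (i j : Fin (n - k)) :
    cartanB (n - k) i j = cartanC n (highNode n k i) (highNode n k j) := by
  have hi := i.2
  have hj := j.2
  simp only [cartanB, cartanC, highNode_val]
  split_ifs <;> omega

/-- The homomorphism `B_k → C̃ₙ` onto the parabolic subgroup of the first `k` nodes. -/
def lowHom {n k : ℕ} (hk : k ≤ n) : (CoxeterMatrix.Bₙ k).Group →* (tCmat n).Group :=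
  diagramHom (csB k) (csC n) (coxeter_lowNode hk)

/-- The homomorphism `B_{n-k} → C̃ₙ` onto the parabolic subgroup of the last `n - k` nodes. -/
def highHom (n k : ℕ) : (CoxeterMatrix.Bₙ (n - k)).Group →* (tCmat n).Group :=
  diagramHom (csB (n - k)) (csC n) (coxeter_highNode n k)

theorem lowHom_simple {n k : ℕ} (hk : k ≤ n) (i : Fin k) :
    lowHom hk ((csB k).simple i) = (csC n).simple (lowNode hk i) :=
  diagramHom_simple _ _ _ i

theorem highHom_simple (n k : ℕ) (i : Fin (n - k)) :
    highHom n k ((csB (n - k)).simple i) = (csC n).simple (highNode n k i) :=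
  diagramHom_simple _ _ _ i

theorem commute_lowHom_highHom {n k : ℕ} (hk : k ≤ n) (u : (CoxeterMatrix.Bₙ k).Group)
    (v : (CoxeterMatrix.Bₙ (n - k)).Group) : Commute (lowHom hk u) (highHom n k v) := by
  induction u using (csB k).simple_induction with
  | one => simp
  | mul u u' h h' => rw [map_mul]; exact h.mul_left h'
  | simple i =>
    induction v using (csB (n - k)).simple_induction with
    | one => simp
    | mul v v' h h' => rw [map_mul]; exact h.mul_right h'
    | simple j =>
      have hM : tCmat n (lowNode hk i) (highNode n k j) = 2 := by
        have hi := i.2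
        have hi' : (lowNode hk i : ℕ) = k - 1 - i := rfl
        have hj' := highNode_val j
        rw [tCmat_apply, if_neg (by omega), if_neg (by omega)]
      have h := (csC n).simple_mul_simple_pow (lowNode hk i) (highNode n k j)
      rw [hM, pow_two, mul_eq_one_iff_eq_inv, mul_inv_rev, CoxeterSystem.inv_simple,
        CoxeterSystem.inv_simple] at h
      rw [lowHom_simple, highHom_simple]
      exact h

theorem length_lowHom_mul_highHom {n k : ℕ} (hn : 2 ≤ n) (hk : k ≤ n)
    (u : (CoxeterMatrix.Bₙ k).Group) (v : (CoxeterMatrix.Bₙ (n - k)).Group) :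
    (csC n).length (lowHom hk u * highHom n k v) =
      (csB k).length u + (csB (n - k)).length v := by
  have hA := isCartan_cartanC hn
  rw [highHom, length_mul_diagramHom _ _ _ hA (isCartan_cartanB _) (cartan_highNode n k), lowHom,
    length_diagramHom _ _ _ hA (isCartan_cartanB _) (cartan_lowNode hk)]
  intro j
  convert root_nonneg (highNode n k j) using 1
  induction u using (csB k).simple_induction_right with
  | one => simp
  | mul_simple_right u i ih =>
    have h0 : cartanC n (lowNode hk i) (highNode n k j) = 0 := by
      have hi := i.2
      simp only [cartanC, lowNode, highNode_val]
      split_ifs <;> omega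
    rw [map_mul, lowHom_simple, rep_mul_simple_apply, coroot_root, h0, ih, zero_smul, sub_zero]

/-- The set of nodes of `C̃ₙ` consisting of the first `k` nodes and, beyond the omitted node `k`,
a set `J` of nodes. -/
def joinNodes (n k : ℕ) (J : Finset (Fin (n - k))) : Finset (Fin (n + 1)) :=
  Finset.univ.filter (fun i : Fin (n + 1) => (i : ℕ) < k) ∪ J.map (highNode n k)

theorem mem_joinNodes {n k : ℕ} {J : Finset (Fin (n - k))} {i : Fin (n + 1)} :
    i ∈ joinNodes n k J ↔ (i : ℕ) < k ∨ ∃ j ∈ J, highNode n k j = i := by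
  simp [joinNodes]

theorem lt_mem_joinNodes {n k : ℕ} {J : Finset (Fin (n - k))} {i : Fin (n + 1)}
    (h : (i : ℕ) < k) : i ∈ joinNodes n k J := mem_joinNodes.2 (Or.inl h)

theorem notMem_joinNodes {n k : ℕ} {J : Finset (Fin (n - k))} {i : Fin (n + 1)}
    (h : (i : ℕ) = k) : i ∉ joinNodes n k J := by
  rw [mem_joinNodes]
  rintro (hi | ⟨j, -, rfl⟩)
  · omega
  · simp only [highNode_val] at h
    omega

theorem highNode_mem_joinNodes {n k : ℕ} {J : Finset (Fin (n - k))} {j : Fin (n - k)} :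
    highNode n k j ∈ joinNodes n k J ↔ j ∈ J := by
  rw [mem_joinNodes]
  constructor
  · rintro (h | ⟨j', hj', h⟩)
    · simp only [highNode_val] at h
      omega
    · rwa [← (highNode n k).injective h]
  · exact fun h => Or.inr ⟨j, h, rfl⟩

theorem joinNodes_injective (n k : ℕ) : Function.Injective (joinNodes n k) := by
  intro J J' h
  ext j
  rw [← highNode_mem_joinNodes, h, highNode_mem_joinNodes]

theorem card_joinNodes {n k : ℕ} (hk : k ≤ n) (J : Finset (Fin (n - k))) :
    (joinNodes n k J).card = k + J.card := by
  rw [joinNodes, Finset.card_union_of_disjoint, Finset.card_map]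
  · congr 1
    have := Fin.card_filter_val_lt (n := n + 1) (m := k)
    omega
  · rw [Finset.disjoint_left]
    intro i hi hi'
    obtain ⟨j, -, rfl⟩ := Finset.mem_map.1 hi'
    simp [highNode_val] at hi
    omega

theorem exists_eq_joinNodes {n : ℕ} {J : Finset (Fin (n + 1))} (hJ : J ≠ Finset.univ) :
    ∃ k ≤ n, ∃ J' : Finset (Fin (n - k)), J = joinNodes n k J' := by
  have hne : ∃ k, ∃ h : k < n + 1, (⟨k, h⟩ : Fin (n + 1)) ∉ J := by
    by_contra! h
    exact hJ (Finset.eq_univ_iff_forall.2 fun i => h i i.2)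
  classical
  obtain ⟨hk, hkJ⟩ := Nat.find_spec hne
  have hmin := fun m => Nat.find_min hne (m := m)
  generalize Nat.find hne = k at hk hkJ hmin
  push Not at hmin
  refine ⟨k, by omega, Finset.univ.filter fun j => highNode n k j ∈ J, ?_⟩
  ext i
  rw [mem_joinNodes]
  constructor
  · intro hi
    rcases lt_trichotomy (i : ℕ) k with h | h | h
    · exact Or.inl h
    · subst h; exact absurd hi hkJ
    · have hi2 := i.2
      have : highNode n k ⟨i - (k + 1), by omega⟩ = i := by
        ext; simp only [highNode_val]; omega
      exact Or.inr ⟨⟨i - (k + 1), by omega⟩, by simpa [this] using hi, this⟩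
  · rintro (h | ⟨j, hj, rfl⟩)
    · exact hmin i h i.2
    · simpa using hj

theorem eq_of_joinNodes_eq {n k k' : ℕ} (hk : k ≤ n) (hk' : k' ≤ n) {J : Finset (Fin (n - k))}
    {J' : Finset (Fin (n - k'))} (h : joinNodes n k J = joinNodes n k' J') : k = k' := by
  rcases lt_trichotomy k k' with hlt | rfl | hlt
  · refine absurd (h ▸ lt_mem_joinNodes (i := ⟨k, by omega⟩) hlt) (notMem_joinNodes rfl)
  · rfl
  · refine absurd (h.symm ▸ lt_mem_joinNodes (i := ⟨k', by omega⟩) hlt) (notMem_joinNodes rfl)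

theorem exists_of_mem_parabolic {n k : ℕ} (hk : k ≤ n) {J : Finset (Fin (n - k))}
    {w : (tCmat n).Group}
    (hw : w ∈ parabolic (csC n) (↑(joinNodes n k J) : Set (Fin (n + 1)))) :
    ∃ u, ∃ v ∈ parabolic (csB (n - k)) (↑J : Set (Fin (n - k))), w = lowHom hk u * highHom n k v := by
  let φ := (lowHom hk).noncommCoprod (highHom n k) (commute_lowHom_highHom hk)
  have hle : parabolic (csC n) (↑(joinNodes n k J) : Set (Fin (n + 1))) ≤
      ((⊤ : Subgroup _).prod (parabolic (csB (n - k)) (↑J : Set (Fin (n - k))))).map φ := by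
    rw [parabolic, Subgroup.closure_le]
    rintro _ ⟨i, hi, rfl⟩
    rcases mem_joinNodes.1 (Finset.mem_coe.1 hi) with h | ⟨j, hj, rfl⟩
    · refine ⟨((csB k).simple ⟨k - 1 - i, by omega⟩, 1), ⟨trivial, one_mem _⟩, ?_⟩
      have : lowNode hk ⟨k - 1 - i, by omega⟩ = i := by
        ext; simp only [lowNode]; omega
      rw [MonoidHom.noncommCoprod_apply, map_one, mul_one, lowHom_simple, this]
    · refine ⟨(1, (csB (n - k)).simple j), ⟨trivial, Subgroup.subset_closure ⟨j, hj, rfl⟩⟩, ?_⟩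
      rw [MonoidHom.noncommCoprod_apply, map_one, one_mul, highHom_simple]
  obtain ⟨⟨u, v⟩, ⟨-, hv⟩, rfl⟩ := hle hw
  exact ⟨u, v, hv, rfl⟩

theorem finite_parabolic_joinNodes {n k : ℕ} (hk : k ≤ n) (J : Finset (Fin (n - k))) :
    (parabolic (csC n) (↑(joinNodes n k J) : Set (Fin (n + 1))) :
      Set (tCmat n).Group).Finite := by
  refine (Set.finite_range fun p : (CoxeterMatrix.Bₙ k).Group × (CoxeterMatrix.Bₙ (n - k)).Group =>
    lowHom hk p.1 * highHom n k p.2).subset fun w hw => ?_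
  obtain ⟨u, v, -, rfl⟩ := exists_of_mem_parabolic hk hw
  exact ⟨(u, v), rfl⟩

theorem length_w0_joinNodes {n k : ℕ} (hn : 2 ≤ n) (hk : k ≤ n) (J : Finset (Fin (n - k))) :
    (csC n).length (w0 (csC n) (↑(joinNodes n k J) : Set (Fin (n + 1)))) =
      k ^ 2 + lenB (n - k) J := by
  obtain ⟨u, hu, -⟩ := exists_neg_one_typeB k
  obtain ⟨v, hvJ, hv, hmax⟩ := exists_length_eq_lenB J
  rw [length_w0_eq (csC n) (w := lowHom hk u * highHom n k v), length_lowHom_mul_highHom hn, hu, hv]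
  · refine mul_mem (diagramHom_mem_parabolic _ _ _ (J' := Set.univ) (fun i _ => ?_) ?_)
      (diagramHom_mem_parabolic _ _ _ (fun j hj => highNode_mem_joinNodes.2 hj) hvJ)
    · have hi := i.2
      exact lt_mem_joinNodes (by simp only [lowNode]; omega)
    · rw [parabolic_univ]
      trivial
  · intro x hx
    obtain ⟨u', v', hv', rfl⟩ := exists_of_mem_parabolic hk hx
    rw [length_lowHom_mul_highHom hn, length_lowHom_mul_highHom hn, hu, hv]
    exact add_le_add (length_le_sq_typeB u') (hmax v' hv')

end AffineC

theorem finite_parabolic_affineC_iff {n : ℕ} (hn : 2 ≤ n) (J : Finset (Fin (n + 1))) :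
    ((parabolic (tCmat n).toCoxeterSystem (↑J : Set (Fin (n + 1)))) :
      Set (tCmat n).Group).Finite ↔ J ≠ Finset.univ := by
  constructor
  · rintro h rfl
    have := infinite_affineC hn
    rw [Finset.coe_univ, parabolic_univ, Subgroup.coe_top] at h
    exact Set.infinite_univ h
  · intro hJ
    obtain ⟨k, hk, J', rfl⟩ := exists_eq_joinNodes hJ
    exact finite_parabolic_joinNodes hk J'

/-- for `n ≥ 2`, every proper parabolic subgroup of `C̃ₙ` is finite
(hence `χ̂_{C̃ₙ}` is a polynomial), and
`χ̂_{C̃ₙ}(q) = Σ_{k=0}^{n} (-1)^k q^(k²) χ̂_{B_{n-k}}(q)`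
(with `χ̂_{B_i} = 1` for `i ≤ 0`). -/
theorem chiAff_tC (n : ℕ) (hn : 2 ≤ n) :
    (∀ J : Finset (Fin (n + 1)), J ≠ Finset.univ →
      ((parabolic (tCmat n).toCoxeterSystem (↑J : Set (Fin (n + 1)))) :
        Set (tCmat n).Group).Finite) ∧
    chiAffC n =
      ∑ k ∈ Finset.range (n + 1),
        (-1 : Polynomial ℤ) ^ k * X ^ (k ^ 2) * chiB (n - k) := by
  refine ⟨fun J hJ => (finite_parabolic_affineC_iff hn J).2 hJ, ?_⟩
  have hset : {J : Finset (Fin (n + 1)) |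
      ((parabolic (tCmat n).toCoxeterSystem (↑J : Set (Fin (n + 1)))) :
        Set (tCmat n).Group).Finite} =
      ↑(Finset.univ.filter fun J : Finset (Fin (n + 1)) => J ≠ Finset.univ) := by
    ext J
    simpa using finite_parabolic_affineC_iff hn J
  rw [chiAffC, hset, finsum_mem_coe_finset]
  simp only [chiB, Finset.mul_sum]
  rw [Finset.sum_sigma']
  symm
  refine Finset.sum_bij (fun p _ => joinNodes n p.1 p.2) ?_ ?_ ?_ ?_
  · rintro ⟨k, J⟩ hp
    simp only [Finset.mem_sigma, Finset.mem_range, Finset.mem_univ, and_true] at hp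
    rw [Finset.mem_filter]
    refine ⟨Finset.mem_univ _, fun h => ?_⟩
    exact notMem_joinNodes (J := J) (i := ⟨k, hp⟩) rfl (h ▸ Finset.mem_univ _)
  · rintro ⟨k, J⟩ hp ⟨k', J'⟩ hp' h
    simp only [Finset.mem_sigma, Finset.mem_range, Finset.mem_univ, and_true] at hp hp'
    obtain rfl : k = k' := eq_of_joinNodes_eq (by omega) (by omega) h
    obtain rfl : J = J' := joinNodes_injective n k h
    rfl
  · intro J hJ
    obtain ⟨k, hk, J', rfl⟩ := exists_eq_joinNodes (Finset.mem_filter.1 hJ).2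
    exact ⟨⟨k, J'⟩, by simp; omega, rfl⟩
  · rintro ⟨k, J⟩ hp
    simp only [Finset.mem_sigma, Finset.mem_range, Finset.mem_univ, and_true] at hp
    have hk : k ≤ n := by omega
    rw [length_w0_joinNodes hn hk, card_joinNodes hk, pow_add, pow_add]
    ring

end CoxeterCharPoly
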